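/- Let t > 0 be a real number, let n ≥ 1 be an integer, and let 0 ≤ n1 ≤ 2n. Then M_{2n,0}(t) = Σ_m M_{n1,m}(t) · M_{2n−n1,m}(t), where the sum runs over all natural numbers m with m ≤ min(n1, 2n−n1) and n1 − m even. (This expresses the decomposition of a weighted Dyck path of length 2n by cutting at position n1, where the right piece is counted after reversal and reflection.) -/

import Mathlib

noncomputable section

open Finset

/-- Height of the path `w` (of length `L`, up = `true`, down = `false`) after `i` steps. -/
def height {L : ℕ} (w : Fin L → Bool) (i : ℕ) : ℤ :=
  ∑ j ∈ Finset.univ.filter (fun j : Fin L => (j : ℕ) < i),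
    (if w j then (1 : ℤ) else -1)

/-- `DyckSet a b`: the set `D_{a,b}` of paths of length `2a+b` with `a+b` up steps whose
heights stay nonnegative. -/
def DyckSet (a b : ℕ) : Finset (Fin (2 * a + b) → Bool) :=
  Finset.univ.filter (fun w =>
    (Finset.univ.filter (fun j => w j = true)).card = a + b ∧
      ∀ i ≤ 2 * a + b, 0 ≤ height w i)

/-- The area `A(w)` between the path `w` and the x-axis. -/
def area {L : ℕ} (w : Fin L → Bool) : ℝ :=
  (∑ i ∈ Finset.range L, ((height w i + height w (i + 1) : ℤ) : ℝ)) / 2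

/-- The weighted path sum `M_{2a+b,b}(t) = Σ_{w ∈ D_{a,b}} t^{A(w)}`. -/
def M (a b : ℕ) (t : ℝ) : ℝ := ∑ w ∈ DyckSet a b, t ^ area w

/-- `M_{ℓ,m}(t)` for `ℓ ≥ m` with `ℓ - m` even. -/
def Mlm (ℓ m : ℕ) (t : ℝ) : ℝ := M ((ℓ - m) / 2) m t

/-- `P k`: the number of partitions of `k`. -/
def P (k : ℕ) : ℕ := Fintype.card (Nat.Partition k)

/-- `C(t) = Σ_{k=0}^∞ P(k) t^{-2k}`. -/
def C (t : ℝ) : ℝ := ∑' k : ℕ, (P k : ℝ) * t ^ (-(2 : ℝ) * k)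

theorem height_zero {L : ℕ} (w : Fin L → Bool) : height w 0 = 0 := by
  simp [height]

theorem height_succ {L : ℕ} (w : Fin L → Bool) {i : ℕ} (hi : i < L) :
    height w (i + 1) = height w i + (if w ⟨i, hi⟩ then (1 : ℤ) else -1) := by
  have h : Finset.univ.filter (fun j : Fin L => (j : ℕ) < i + 1) =
      insert ⟨i, hi⟩ (Finset.univ.filter (fun j : Fin L => (j : ℕ) < i)) := by
    ext j
    simp only [mem_filter, mem_univ, true_and, mem_insert, Fin.ext_iff]
    omega
  unfold height
  rw [h, Finset.sum_insert (by simp), add_comm]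

theorem height_length {L : ℕ} (w : Fin L → Bool) :
    height w L = 2 * ((Finset.univ.filter (fun j => w j = true)).card : ℤ) - L := by
  have h : ∀ j, (if w j then (1 : ℤ) else -1) = 2 * (if w j = true then 1 else 0) - 1 := by
    intro j
    split_ifs <;> norm_num
  simp only [height, Fin.is_lt, Finset.filter_true, h, Finset.sum_sub_distrib, ← Finset.mul_sum,
    Finset.sum_boole]
  simp

theorem height_length_le {L : ℕ} (w : Fin L → Bool) : height w L ≤ L := by
  have h := Finset.card_le_univ (Finset.univ.filter (fun j => w j = true))
  rw [Fintype.card_fin] at h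
  rw [height_length]
  omega

theorem height_append_left {p q : ℕ} (u : Fin p → Bool) (v : Fin q → Bool) {i : ℕ}
    (hi : i ≤ p) : height (Fin.append u v) i = height u i := by
  induction i with
  | zero => simp only [height_zero]
  | succ i ih =>
    rw [height_succ _ (by omega : i < p + q), height_succ u (by omega : i < p), ih (by omega)]
    have h : Fin.append u v ⟨i, by omega⟩ = u ⟨i, by omega⟩ := Fin.append_left u v ⟨i, by omega⟩
    rw [h]

theorem height_append_right {p q : ℕ} (u : Fin p → Bool) (v : Fin q → Bool) {i : ℕ}
    (hi : i ≤ q) : height (Fin.append u v) (p + i) = height u p + height v i := by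
  induction i with
  | zero => rw [add_zero, height_append_left u v le_rfl, height_zero, add_zero]
  | succ i ih =>
    rw [← add_assoc, height_succ _ (by omega : p + i < p + q), height_succ v (by omega : i < q),
      ih (by omega)]
    have h : Fin.append u v ⟨p + i, by omega⟩ = v ⟨i, by omega⟩ :=
      Fin.append_right u v ⟨i, by omega⟩
    rw [h, add_assoc]

/-- The path traversed backwards: reverse the steps and exchange up and down. -/
def reversePath {L : ℕ} (w : Fin L → Bool) : Fin L → Bool := fun i => !w i.rev

theorem reversePath_reversePath {L : ℕ} (w : Fin L → Bool) :
    reversePath (reversePath w) = w := by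
  funext i
  simp [reversePath]

theorem height_reversePath {L : ℕ} (w : Fin L → Bool) {i : ℕ} (hi : i ≤ L) :
    height (reversePath w) i = height w (L - i) - height w L := by
  induction i with
  | zero => simp [height_zero]
  | succ i ih =>
    have hs := height_succ w (by omega : L - (i + 1) < L)
    rw [show L - (i + 1) + 1 = L - i by omega] at hs
    have h : reversePath w ⟨i, by omega⟩ = !w ⟨L - (i + 1), by omega⟩ := rfl
    rw [height_succ _ (by omega : i < L), ih (by omega), hs, h]
    cases w ⟨L - (i + 1), by omega⟩ <;> simp <;> ring

theorem area_append_reversePath {p q : ℕ} (u : Fin p → Bool) (v : Fin q → Bool)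
    (h : height u p = height v q) :
    area (Fin.append u (reversePath v)) = area u + area v := by
  unfold area
  rw [Finset.sum_range_add, add_div]
  congr 2
  · refine Finset.sum_congr rfl fun i hi => ?_
    rw [Finset.mem_range] at hi
    rw [height_append_left _ _ hi.le, height_append_left _ _ hi]
  · rw [← Finset.sum_range_reflect]
    refine Finset.sum_congr rfl fun i hi => ?_
    rw [Finset.mem_range] at hi
    rw [add_assoc, height_append_right _ _ (by omega), height_append_right _ _ (by omega),
      height_reversePath _ (by omega), height_reversePath _ (by omega), h,
      show q - (q - 1 - i) = i + 1 by omega, show q - (q - 1 - i + 1) = i by omega]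
    congr 1
    ring

/-- The paths of length `L` with final height `m` whose heights stay nonnegative. -/
def nonnegPaths (L m : ℕ) : Finset (Fin L → Bool) :=
  Finset.univ.filter (fun w => height w L = m ∧ ∀ i ≤ L, 0 ≤ height w i)

theorem mem_nonnegPaths {L m : ℕ} {w : Fin L → Bool} :
    w ∈ nonnegPaths L m ↔ height w L = m ∧ ∀ i ≤ L, 0 ≤ height w i := by
  simp [nonnegPaths]

theorem Mlm_eq_sum_nonnegPaths {ℓ m : ℕ} (t : ℝ) (hm : m ≤ ℓ) (hpar : (ℓ - m) % 2 = 0) :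
    Mlm ℓ m t = ∑ w ∈ nonnegPaths ℓ m, t ^ area w := by
  obtain ⟨a, rfl⟩ : ∃ a, ℓ = 2 * a + m := ⟨(ℓ - m) / 2, by omega⟩
  rw [Mlm, show (2 * a + m - m) / 2 = a by omega, M]
  refine Finset.sum_congr (Finset.filter_congr fun w _ => and_congr_left' ?_) fun _ _ => rfl
  rw [height_length]
  push_cast
  omega

theorem append_reversePath_mem_nonnegPaths {p q : ℕ} {u : Fin p → Bool} {v : Fin q → Bool} :
    Fin.append u (reversePath v) ∈ nonnegPaths (p + q) 0 ↔
      height u p = height v q ∧ (∀ i ≤ p, 0 ≤ height u i) ∧ ∀ i ≤ q, 0 ≤ height v i := by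
  have hr : ∀ i ≤ q, height (Fin.append u (reversePath v)) (p + i) =
      height u p + (height v (q - i) - height v q) := fun i hi => by
    rw [height_append_right _ _ hi, height_reversePath _ hi]
  rw [mem_nonnegPaths, hr q le_rfl, Nat.sub_self, height_zero]
  constructor
  · rintro ⟨h, hnn⟩
    refine ⟨by push_cast at h; omega, fun i hi => ?_, fun i hi => ?_⟩
    · rw [← height_append_left u (reversePath v) hi]
      exact hnn i (by omega)
    · have := hnn (p + (q - i)) (by omega)
      rw [hr _ (by omega), show q - (q - i) = i by omega] at this
      push_cast at h
      omega
  · rintro ⟨h, hu, hv⟩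
    refine ⟨by push_cast; omega, fun i hi => ?_⟩
    rcases le_total i p with hip | hip
    · rw [height_append_left _ _ hip]
      exact hu i hip
    · obtain ⟨k, rfl⟩ := Nat.exists_eq_add_of_le hip
      rw [hr k (by omega)]
      have := hv (q - k) (by omega)
      omega

theorem exists_append_reversePath {p q : ℕ} (w : Fin (p + q) → Bool) :
    ∃ (u : Fin p → Bool) (v : Fin q → Bool), Fin.append u (reversePath v) = w :=
  ⟨fun i => w (Fin.castAdd q i), reversePath fun i => w (Fin.natAdd p i), by
    rw [reversePath_reversePath, Fin.append_castAdd_natAdd]⟩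

theorem append_reversePath_injective {p q : ℕ} :
    Function.Injective
      (fun x : (Fin p → Bool) × (Fin q → Bool) => Fin.append x.1 (reversePath x.2)) := by
  rintro ⟨u, v⟩ ⟨u', v'⟩ h
  obtain ⟨hu, hv⟩ := Prod.ext_iff.1 ((Fin.appendEquiv p q).injective
    (a₁ := (u, reversePath v)) (a₂ := (u', reversePath v')) h)
  have := congrArg reversePath hv
  simp only [reversePath_reversePath] at this
  exact Prod.ext hu this

theorem sum_nonnegPaths_add {t : ℝ} (ht : 0 < t) (p q : ℕ) :
    ∑ w ∈ nonnegPaths (p + q) 0, t ^ area w =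
      ∑ m ∈ (Finset.range (min p q + 1)).filter (fun m => (p - m) % 2 = 0),
        (∑ u ∈ nonnegPaths p m, t ^ area u) * ∑ v ∈ nonnegPaths q m, t ^ area v := by
  rw [← Finset.sum_fiberwise_of_maps_to (g := fun w => (height w p).toNat)]
  · refine Finset.sum_congr rfl fun m _ => ?_
    rw [Finset.sum_mul_sum, ← Finset.sum_product']
    symm
    refine Finset.sum_bij (fun x _ => Fin.append x.1 (reversePath x.2)) ?_
      (fun _ _ _ _ h => append_reversePath_injective h) ?_ ?_
    · rintro ⟨u, v⟩ hx
      obtain ⟨⟨hu, hu'⟩, hv, hv'⟩ : (_ ∧ _) ∧ _ ∧ _ := by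
        simpa only [Finset.mem_product, mem_nonnegPaths] using hx
      rw [Finset.mem_filter, append_reversePath_mem_nonnegPaths, height_append_left _ _ le_rfl]
      exact ⟨⟨hu.trans hv.symm, hu', hv'⟩, by simp [hu]⟩
    · intro w hw
      obtain ⟨u, v, rfl⟩ := exists_append_reversePath w
      rw [Finset.mem_filter, append_reversePath_mem_nonnegPaths,
        height_append_left _ _ le_rfl] at hw
      obtain ⟨⟨h, hu, hv⟩, hm⟩ := hw
      have := hu p le_rfl
      refine ⟨(u, v), ?_, rfl⟩
      rw [Finset.mem_product, mem_nonnegPaths, mem_nonnegPaths]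
      exact ⟨⟨by dsimp only; omega, hu⟩, by dsimp only; omega, hv⟩
    · rintro ⟨u, v⟩ hx
      rw [Finset.mem_product, mem_nonnegPaths, mem_nonnegPaths] at hx
      rw [area_append_reversePath _ _ (hx.1.1.trans hx.2.1.symm), Real.rpow_add ht]
  · intro w hw
    obtain ⟨u, v, rfl⟩ := exists_append_reversePath w
    obtain ⟨h, hu, -⟩ := append_reversePath_mem_nonnegPaths.1 hw
    have h0 := hu p le_rfl
    have h1 := height_length_le u
    have h2 := height_length_le v
    have h3 := height_length u
    rw [Finset.mem_filter, Finset.mem_range, height_append_left _ _ le_rfl]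
    omega

/-- Decomposition of a weighted Dyck path of length `2n` by cutting at position `n1`:
`M_{2n,0}(t) = Σ_m M_{n1,m}(t) M_{2n-n1,m}(t)`, the sum over `m ≤ min(n1, 2n-n1)`
with `n1 - m` even. -/
theorem stmt_7 (t : ℝ) (ht : 0 < t) (n : ℕ) (hn : 1 ≤ n) (n1 : ℕ) (hn1 : n1 ≤ 2 * n) :
    Mlm (2 * n) 0 t =
      ∑ m ∈ (Finset.range (min n1 (2 * n - n1) + 1)).filter (fun m => (n1 - m) % 2 = 0),
        Mlm n1 m t * Mlm (2 * n - n1) m t := by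
  obtain ⟨q, hq⟩ := Nat.exists_eq_add_of_le hn1
  rw [Mlm_eq_sum_nonnegPaths t (Nat.zero_le _) (by omega), hq, Nat.add_sub_cancel_left,
    sum_nonnegPaths_add ht]
  refine Finset.sum_congr rfl fun m hm => ?_
  rw [Finset.mem_filter, Finset.mem_range] at hm
  rw [Mlm_eq_sum_nonnegPaths t (by omega) hm.2,
    Mlm_eq_sum_nonnegPaths t (by omega : m ≤ q) (by omega)]
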